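/- For every α>0 and every real y>0, the contour integral (1/2πi)∫_{(α)} y^s/s³ ds (taken over the vertical line Re(s)=α) equals (log² y)/2 if y ≥ 1, and equals 0 if 0 < y ≤ 1. -/

import Mathlib

open scoped Real
open MeasureTheory

noncomputable section

/-- The function `t ↦ t₊² e^{-αt} / 2`, whose Fourier transform is `ξ ↦ (α + 2πiξ)⁻³`. -/
def truncatedSqExp (α t : ℝ) : ℂ := (((max t 0) ^ 2 / 2 * Real.exp (-α * t) : ℝ) : ℂ)

lemma continuous_truncatedSqExp (α : ℝ) : Continuous (truncatedSqExp α) := by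
  unfold truncatedSqExp
  fun_prop

lemma truncatedSqExp_eq_indicator (α : ℝ) :
    truncatedSqExp α = (Set.Ioi (0 : ℝ)).indicator
      fun t => (((t ^ 2 / 2 * Real.exp (-α * t) : ℝ)) : ℂ) := by
  ext t
  by_cases h : 0 < t
  · simp [truncatedSqExp, h, max_eq_left h.le]
  · simp [truncatedSqExp, h, max_eq_right (not_lt.1 h)]

lemma integrable_truncatedSqExp {α : ℝ} (hα : 0 < α) : Integrable (truncatedSqExp α) := by
  rw [truncatedSqExp_eq_indicator, integrable_indicator_iff measurableSet_Ioi]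
  have h := integrableOn_rpow_mul_exp_neg_mul_rpow (p := 1) (s := 2) (b := α)
    (by norm_num) one_pos hα
  refine Integrable.ofReal (𝕜 := ℂ) (f := fun t : ℝ => t ^ 2 / 2 * Real.exp (-α * t))
    ((h.const_mul (1 / 2)).congr (Filter.Eventually.of_forall fun t => ?_))
  simp only [Real.rpow_one, Real.rpow_two]
  ring

lemma tendsto_pow_mul_cexp_neg_mul {z : ℂ} (hz : 0 < z.re) (n : ℕ) :
    Filter.Tendsto (fun t : ℝ => (t : ℂ) ^ n * Complex.exp (-z * t)) Filter.atTop (nhds 0) := by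
  rw [tendsto_zero_iff_norm_tendsto_zero]
  refine (tendsto_rpow_mul_exp_neg_mul_atTop_nhds_zero n z.re hz).congr' ?_
  filter_upwards [Filter.eventually_ge_atTop 0] with t ht
  simp [Complex.norm_exp, abs_of_nonneg ht]

lemma integral_Ioi_sq_mul_cexp_neg_mul {z : ℂ} (hz : 0 < z.re)
    (hint : IntegrableOn (fun t : ℝ => (t : ℂ) ^ 2 / 2 * Complex.exp (-z * t)) (Set.Ioi 0)) :
    ∫ t in Set.Ioi (0 : ℝ), (t : ℂ) ^ 2 / 2 * Complex.exp (-z * t) = 1 / z ^ 3 := by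
  have hz0 : z ≠ 0 := fun h => by simp [h] at hz
  let F : ℝ → ℂ := fun t => -(1 / (2 * z)) * ((t : ℂ) ^ 2 * Complex.exp (-z * t))
    + -(1 / z ^ 2) * ((t : ℂ) ^ 1 * Complex.exp (-z * t))
    + -(1 / z ^ 3) * ((t : ℂ) ^ 0 * Complex.exp (-z * t))
  have hderiv : ∀ t : ℝ, HasDerivAt F ((t : ℂ) ^ 2 / 2 * Complex.exp (-z * t)) t := by
    intro t
    have hid : HasDerivAt (fun t : ℝ => (t : ℂ)) 1 t := Complex.ofRealCLM.hasDerivAt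
    have hexp := (hid.const_mul (-z)).cexp
    have hmul := fun n : ℕ => (hid.pow n).mul hexp
    have hF := (((hmul 2).const_mul (-(1 / (2 * z)))).add
      ((hmul 1).const_mul (-(1 / z ^ 2)))).add ((hmul 0).const_mul (-(1 / z ^ 3)))
    refine hF.congr_deriv ?_
    simp
    field_simp
    ring
  have hlim : Filter.Tendsto F Filter.atTop (nhds 0) := by
    simpa only [mul_zero, add_zero] using ((((tendsto_pow_mul_cexp_neg_mul hz 2).const_mul (-(1 / (2 * z)))).add
      ((tendsto_pow_mul_cexp_neg_mul hz 1).const_mul (-(1 / z ^ 2)))).add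
      ((tendsto_pow_mul_cexp_neg_mul hz 0).const_mul (-(1 / z ^ 3))))
  rw [integral_Ioi_of_hasDerivAt_of_tendsto' (fun t _ => hderiv t) hint hlim]
  simp [F]

open FourierTransform in
lemma fourier_truncatedSqExp {α : ℝ} (hα : 0 < α) (ξ : ℝ) :
    𝓕 (truncatedSqExp α) ξ = 1 / ((α : ℂ) + (2 * π * ξ : ℝ) * Complex.I) ^ 3 := by
  have key : ∀ t : ℝ, Complex.exp (↑(-2 * π * t * ξ) * Complex.I) • truncatedSqExp α t =
      (Set.Ioi (0 : ℝ)).indicator (fun t : ℝ => (t : ℂ) ^ 2 / 2 *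
        Complex.exp (-((α : ℂ) + (2 * π * ξ : ℝ) * Complex.I) * t)) t := by
    intro t
    rw [truncatedSqExp_eq_indicator]
    by_cases h : t ∈ Set.Ioi (0 : ℝ)
    · simp only [Set.indicator_of_mem h, smul_eq_mul]
      push_cast
      rw [mul_left_comm, ← Complex.exp_add]
      ring_nf
    · simp only [Set.indicator_of_notMem h, smul_zero]
  have hint : Integrable fun t : ℝ =>
      Complex.exp (↑(-2 * π * t * ξ) * Complex.I) • truncatedSqExp α t := by
    refine (integrable_truncatedSqExp hα).mono
      ((show Continuous fun t : ℝ => Complex.exp (↑(-2 * π * t * ξ) * Complex.I) by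
        fun_prop).smul (continuous_truncatedSqExp α)).aestronglyMeasurable
      (Filter.Eventually.of_forall fun t => ?_)
    rw [norm_smul, Complex.norm_exp_ofReal_mul_I, one_mul]
  rw [Real.fourier_real_eq_integral_exp_smul]
  simp_rw [key] at hint ⊢
  rw [integral_indicator measurableSet_Ioi]
  exact integral_Ioi_sq_mul_cexp_neg_mul (by simpa using hα)
    ((integrable_indicator_iff measurableSet_Ioi).1 hint)

lemma add_mul_I_ne_zero {α : ℝ} (hα : 0 < α) (u : ℝ) : (α : ℂ) + u * Complex.I ≠ 0 :=
  fun h => hα.ne' (by simpa using congrArg Complex.re h)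

lemma integrable_one_div_add_mul_I_cube {α : ℝ} (hα : 0 < α) :
    Integrable fun u : ℝ => 1 / ((α : ℂ) + u * Complex.I) ^ 3 := by
  have hne := add_mul_I_ne_zero hα
  have hcont : Continuous fun u : ℝ => 1 / ((α : ℂ) + u * Complex.I) ^ 3 :=
    continuous_const.div (by fun_prop) fun u => pow_ne_zero 3 (hne u)
  have hdom : Integrable fun u : ℝ => α⁻¹ ^ 3 * (1 + (α⁻¹ * u) ^ 2)⁻¹ :=
    (integrable_inv_one_add_sq.comp_mul_left' (inv_ne_zero hα.ne')).const_mul _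
  refine hdom.mono' hcont.aestronglyMeasurable (Filter.Eventually.of_forall fun u => ?_)
  have hsq : ‖(α : ℂ) + u * Complex.I‖ ^ 2 = α ^ 2 + u ^ 2 := by
    rw [Complex.sq_norm, Complex.normSq_add_mul_I]
  have hle : α ≤ ‖(α : ℂ) + u * Complex.I‖ := by
    simpa using (le_abs_self _).trans (Complex.abs_re_le_norm ((α : ℂ) + u * Complex.I))
  have hbound : α * (α ^ 2 + u ^ 2) ≤ ‖(α : ℂ) + u * Complex.I‖ ^ 3 := by
    rw [pow_succ' ‖(α : ℂ) + u * Complex.I‖, hsq]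
    gcongr
  rw [norm_div, norm_one, norm_pow]
  calc 1 / ‖(α : ℂ) + u * Complex.I‖ ^ 3 ≤ 1 / (α * (α ^ 2 + u ^ 2)) :=
        one_div_le_one_div_of_le (by positivity) hbound
    _ = α⁻¹ ^ 3 * (1 + (α⁻¹ * u) ^ 2)⁻¹ := by field_simp

open FourierTransform in
lemma integral_cexp_div_add_mul_I_cube {α : ℝ} (hα : 0 < α) (x : ℝ) :
    ∫ u : ℝ, Complex.exp (x * u * Complex.I) / ((α : ℂ) + u * Complex.I) ^ 3 =
      2 * π * truncatedSqExp α x := by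
  have hfun : 𝓕 (truncatedSqExp α) =
      fun ξ : ℝ => 1 / ((α : ℂ) + (2 * π * ξ : ℝ) * Complex.I) ^ 3 :=
    funext (fourier_truncatedSqExp hα)
  have hint : Integrable (𝓕 (truncatedSqExp α)) := by
    rw [hfun]
    exact (integrable_one_div_add_mul_I_cube hα).comp_mul_left' Real.two_pi_pos.ne'
  have hinv := (integrable_truncatedSqExp hα).fourierInv_fourier_eq hint
    (continuous_truncatedSqExp α).continuousAt (v := x)
  have hsub := Measure.integral_comp_mul_left
    (fun u : ℝ => Complex.exp (x * u * Complex.I) / ((α : ℂ) + u * Complex.I) ^ 3) (2 * π)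
  have hcongr : ∫ ξ : ℝ, Complex.exp (x * ↑(2 * π * ξ) * Complex.I) /
      ((α : ℂ) + ↑(2 * π * ξ) * Complex.I) ^ 3 = truncatedSqExp α x := by
    rw [← hinv, hfun, Real.fourierInv_eq']
    refine integral_congr_ae (Filter.Eventually.of_forall fun ξ => ?_)
    simp only [RCLike.inner_apply, conj_trivial, smul_eq_mul, mul_one_div]
    push_cast
    ring_nf
  rw [hcongr, abs_of_pos (inv_pos.2 Real.two_pi_pos)] at hsub
  have hpi : ((2 * π : ℝ) : ℂ) ≠ 0 := Complex.ofReal_ne_zero.2 Real.two_pi_pos.ne'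
  rw [hsub, Complex.real_smul, Complex.ofReal_inv, ← Complex.ofReal_ofNat, ← Complex.ofReal_mul,
    mul_inv_cancel_left₀ hpi]

/-- The discontinuous integral: for `α > 0` and `y > 0`, writing `s = α + iu`,
`(1/2πi) ∫_{(α)} y^s/s³ ds = (log² y)/2` if `y ≥ 1` and `= 0` if `0 < y ≤ 1`. -/
theorem discontinuous_integral (α y : ℝ) (hα : 0 < α) (hy : 0 < y) :
    (1 / (2 * (π : ℂ) * Complex.I)) *
      ∫ u : ℝ, (y : ℂ) ^ ((α : ℂ) + u * Complex.I) / ((α : ℂ) + u * Complex.I) ^ 3 *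
        Complex.I =
    if 1 ≤ y then (((Real.log y) ^ 2 / 2 : ℝ) : ℂ) else 0 := by
  have hlog : ∀ u : ℝ, (y : ℂ) ^ ((α : ℂ) + u * Complex.I) / ((α : ℂ) + u * Complex.I) ^ 3 *
      Complex.I = (Complex.exp (α * Real.log y) * Complex.I) *
        (Complex.exp (Real.log y * u * Complex.I) / ((α : ℂ) + u * Complex.I) ^ 3) := by
    intro u
    rw [Complex.cpow_def_of_ne_zero (Complex.ofReal_ne_zero.2 hy.ne'), ← Complex.ofReal_log hy.le,
      show (Real.log y : ℂ) * ((α : ℂ) + u * Complex.I) =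
        α * Real.log y + Real.log y * u * Complex.I by ring, Complex.exp_add]
    ring
  have hpi : (π : ℂ) ≠ 0 := Complex.ofReal_ne_zero.2 Real.pi_ne_zero
  have hcancel : Complex.exp (α * Real.log y) * truncatedSqExp α (Real.log y) =
      ((max (Real.log y) 0 ^ 2 / 2 : ℝ) : ℂ) := by
    rw [truncatedSqExp, Complex.ofReal_mul, mul_left_comm, Complex.ofReal_exp, ← Complex.exp_add]
    push_cast
    rw [neg_mul, add_neg_cancel, Complex.exp_zero, mul_one]
  have hval : (if 1 ≤ y then (((Real.log y) ^ 2 / 2 : ℝ) : ℂ) else 0) =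
      ((max (Real.log y) 0 ^ 2 / 2 : ℝ) : ℂ) := by
    split_ifs with h
    · rw [max_eq_left (Real.log_nonneg h)]
    · rw [max_eq_right (Real.log_nonpos hy.le (not_le.1 h).le)]
      simp
  simp_rw [hlog]
  rw [integral_const_mul, integral_cexp_div_add_mul_I_cube hα, hval, ← hcancel]
  field_simp
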